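/- Suppose the L_{[<n]}-formula φ is consistent with J_n.lin. Then there is a maximal J_n.lin-consistent set x* of L_{[<n]}-formulas such that φ ∈ x* and x* is 0-maximal; indeed, 0-maximality can be witnessed by ψ = ¬φ, i.e., φ ∧ ⋀_{k<n}[k]¬φ ∈ x*. -/

import Mathlib

/-- Formulas of the polymodal language `L_{[<ω]}`: propositional variables,
a constant ⊤, Boolean connectives, and a modality `[m]` for each `m : ℕ`. -/
inductive Formula : Type
  | var : ℕ → Formula
  | top : Formula
  | neg : Formula → Formula
  | and : Formula → Formula → Formula
  | or : Formula → Formula → Formula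
  | imp : Formula → Formula → Formula
  | box : ℕ → Formula → Formula
  deriving DecidableEq

namespace Formula

/-- `⊥` abbreviates `¬⊤`. -/
def bot : Formula := neg top

/-- `⟨m⟩φ` abbreviates `¬[m]¬φ`. -/
def dia (m : ℕ) (φ : Formula) : Formula := neg (box m (neg φ))

/-- A formula is closed if it contains no propositional variables. -/
def Closed : Formula → Prop
  | var _ => False
  | top => True
  | neg a => Closed a
  | and a b => Closed a ∧ Closed b
  | or a b => Closed a ∧ Closed b
  | imp a b => Closed a ∧ Closed b
  | box _ a => Closed a

/-- Membership in the language `L_{[<n]}`: all modalities `[m]` have `m < n`. -/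
def InLang (n : ℕ) : Formula → Prop
  | var _ => True
  | top => True
  | neg a => InLang n a
  | and a b => InLang n a ∧ InLang n b
  | or a b => InLang n a ∧ InLang n b
  | imp a b => InLang n a ∧ InLang n b
  | box m a => m < n ∧ InLang n a

/-- Uniform substitution of formulas for propositional variables. -/
def subst (σ : ℕ → Formula) : Formula → Formula
  | var i => σ i
  | top => top
  | neg a => neg (subst σ a)
  | and a b => and (subst σ a) (subst σ b)
  | or a b => or (subst σ a) (subst σ b)
  | imp a b => imp (subst σ a) (subst σ b)
  | box m a => box m (subst σ a)

/-- The number of occurrences of modal operators in a formula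
(diamonds `⟨m⟩` are abbreviations `¬[m]¬`, so each is one box occurrence). -/
def modalCount : Formula → ℕ
  | var _ => 0
  | top => 0
  | neg a => modalCount a
  | and a b => modalCount a + modalCount b
  | or a b => modalCount a + modalCount b
  | imp a b => modalCount a + modalCount b
  | box _ a => modalCount a + 1

end Formula

/-- Conjunction of a finite list of formulas. -/
def bigConj (l : List Formula) : Formula := l.foldr Formula.and Formula.top

/-- `⋀_{m ≤ k < n} [k]φ`. -/
def boxConj (m n : ℕ) (φ : Formula) : Formula :=
  bigConj ((List.range' m (n - m)).map fun k => Formula.box k φ)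

/-- The pseudo-linearity axiom
`[m]((⋀_{m≤k<n}[k]φ) → ψ) ∨ [m]((⋀_{m≤k<n}[k]ψ ∧ ψ) → φ)`. -/
def psLin (n m : ℕ) (φ ψ : Formula) : Formula :=
  Formula.or
    (Formula.box m (Formula.imp (boxConj m n φ) ψ))
    (Formula.box m (Formula.imp (Formula.and (boxConj m n ψ) ψ) φ))

/-- A Boolean valuation of formulas respecting the Boolean connectives
(treating boxed formulas and variables as atoms). -/
def RespectsBool (v : Formula → Bool) : Prop :=
  v Formula.top = true ∧
  (∀ a, v (Formula.neg a) = !(v a)) ∧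
  (∀ a b, v (Formula.and a b) = (v a && v b)) ∧
  (∀ a b, v (Formula.or a b) = (v a || v b)) ∧
  (∀ a b, v (Formula.imp a b) = (!(v a) || v b))

/-- Propositional tautologies of the modal language. -/
def Tautology (φ : Formula) : Prop :=
  ∀ v : Formula → Bool, RespectsBool v → v φ = true

/-- Japaridze's polymodal provability logic `GLP`. -/
inductive GLP : Formula → Prop
  | taut {φ : Formula} : Tautology φ → GLP φ
  | distr (m : ℕ) (φ ψ : Formula) :
      GLP (Formula.imp (Formula.box m (Formula.imp φ ψ))
        (Formula.imp (Formula.box m φ) (Formula.box m ψ)))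
  | lob (m : ℕ) (φ : Formula) :
      GLP (Formula.imp (Formula.box m (Formula.imp (Formula.box m φ) φ)) (Formula.box m φ))
  | mono (m : ℕ) (φ : Formula) :
      GLP (Formula.imp (Formula.box m φ) (Formula.box (m + 1) φ))
  | diaMono (m : ℕ) (φ : Formula) :
      GLP (Formula.imp (Formula.dia m φ) (Formula.box (m + 1) (Formula.dia m φ)))
  | mp {φ ψ : Formula} : GLP (Formula.imp φ ψ) → GLP φ → GLP ψ
  | nec (m : ℕ) {φ : Formula} : GLP φ → GLP (Formula.box m φ)

/-- The logic `GLP.3`: `GLP` together with the linearity axioms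
`[m]([m]A → B) ∨ [m]([m]B ∧ B → A)`. -/
inductive GLP3 : Formula → Prop
  | taut {φ : Formula} : Tautology φ → GLP3 φ
  | distr (m : ℕ) (φ ψ : Formula) :
      GLP3 (Formula.imp (Formula.box m (Formula.imp φ ψ))
        (Formula.imp (Formula.box m φ) (Formula.box m ψ)))
  | lob (m : ℕ) (φ : Formula) :
      GLP3 (Formula.imp (Formula.box m (Formula.imp (Formula.box m φ) φ)) (Formula.box m φ))
  | mono (m : ℕ) (φ : Formula) :
      GLP3 (Formula.imp (Formula.box m φ) (Formula.box (m + 1) φ))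
  | diaMono (m : ℕ) (φ : Formula) :
      GLP3 (Formula.imp (Formula.dia m φ) (Formula.box (m + 1) (Formula.dia m φ)))
  | lin (m : ℕ) (A B : Formula) :
      GLP3 (Formula.or (Formula.box m (Formula.imp (Formula.box m A) B))
        (Formula.box m (Formula.imp (Formula.and (Formula.box m B) B) A)))
  | mp {φ ψ : Formula} : GLP3 (Formula.imp φ ψ) → GLP3 φ → GLP3 ψ
  | nec (m : ℕ) {φ : Formula} : GLP3 φ → GLP3 (Formula.box m φ)

/-- The logic `GLP_n`, i.e. `GLP` restricted to the language `L_{[<n]}`. -/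
inductive GLPn (n : ℕ) : Formula → Prop
  | taut {φ : Formula} : Tautology φ → Formula.InLang n φ → GLPn n φ
  | distr {m : ℕ} (hm : m < n) (φ ψ : Formula)
      (hφ : Formula.InLang n φ) (hψ : Formula.InLang n ψ) :
      GLPn n (Formula.imp (Formula.box m (Formula.imp φ ψ))
        (Formula.imp (Formula.box m φ) (Formula.box m ψ)))
  | lob {m : ℕ} (hm : m < n) (φ : Formula) (hφ : Formula.InLang n φ) :
      GLPn n (Formula.imp (Formula.box m (Formula.imp (Formula.box m φ) φ)) (Formula.box m φ))
  | mono {m : ℕ} (hm : m + 1 < n) (φ : Formula) (hφ : Formula.InLang n φ) :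
      GLPn n (Formula.imp (Formula.box m φ) (Formula.box (m + 1) φ))
  | diaMono {m : ℕ} (hm : m + 1 < n) (φ : Formula) (hφ : Formula.InLang n φ) :
      GLPn n (Formula.imp (Formula.dia m φ) (Formula.box (m + 1) (Formula.dia m φ)))
  | mp {φ ψ : Formula} : GLPn n (Formula.imp φ ψ) → GLPn n φ → GLPn n ψ
  | nec {m : ℕ} (hm : m < n) {φ : Formula} : GLPn n φ → GLPn n (Formula.box m φ)

/-- The logic `GLP_n.3`: `GLP_n` with the linearity axioms for each `m < n`. -/
inductive GLPn3 (n : ℕ) : Formula → Prop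
  | taut {φ : Formula} : Tautology φ → Formula.InLang n φ → GLPn3 n φ
  | distr {m : ℕ} (hm : m < n) (φ ψ : Formula)
      (hφ : Formula.InLang n φ) (hψ : Formula.InLang n ψ) :
      GLPn3 n (Formula.imp (Formula.box m (Formula.imp φ ψ))
        (Formula.imp (Formula.box m φ) (Formula.box m ψ)))
  | lob {m : ℕ} (hm : m < n) (φ : Formula) (hφ : Formula.InLang n φ) :
      GLPn3 n (Formula.imp (Formula.box m (Formula.imp (Formula.box m φ) φ)) (Formula.box m φ))
  | mono {m : ℕ} (hm : m + 1 < n) (φ : Formula) (hφ : Formula.InLang n φ) :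
      GLPn3 n (Formula.imp (Formula.box m φ) (Formula.box (m + 1) φ))
  | diaMono {m : ℕ} (hm : m + 1 < n) (φ : Formula) (hφ : Formula.InLang n φ) :
      GLPn3 n (Formula.imp (Formula.dia m φ) (Formula.box (m + 1) (Formula.dia m φ)))
  | lin {m : ℕ} (hm : m < n) (A B : Formula)
      (hA : Formula.InLang n A) (hB : Formula.InLang n B) :
      GLPn3 n (Formula.or (Formula.box m (Formula.imp (Formula.box m A) B))
        (Formula.box m (Formula.imp (Formula.and (Formula.box m B) B) A)))
  | mp {φ ψ : Formula} : GLPn3 n (Formula.imp φ ψ) → GLPn3 n φ → GLPn3 n ψ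
  | nec {m : ℕ} (hm : m < n) {φ : Formula} : GLPn3 n φ → GLPn3 n (Formula.box m φ)

/-- Beklemishev's logic `J_n`. -/
inductive Jn (n : ℕ) : Formula → Prop
  | taut {φ : Formula} : Tautology φ → Formula.InLang n φ → Jn n φ
  | distr {k : ℕ} (hk : k < n) (φ ψ : Formula)
      (hφ : Formula.InLang n φ) (hψ : Formula.InLang n ψ) :
      Jn n (Formula.imp (Formula.box k (Formula.imp φ ψ))
        (Formula.imp (Formula.box k φ) (Formula.box k ψ)))
  | lob {k : ℕ} (hk : k < n) (φ : Formula) (hφ : Formula.InLang n φ) :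
      Jn n (Formula.imp (Formula.box k (Formula.imp (Formula.box k φ) φ)) (Formula.box k φ))
  | trans1 {k m : ℕ} (hkm : k ≤ m) (hm : m < n) (φ : Formula) (hφ : Formula.InLang n φ) :
      Jn n (Formula.imp (Formula.box k φ) (Formula.box k (Formula.box m φ)))
  | trans2 {k m : ℕ} (hkm : k ≤ m) (hm : m < n) (φ : Formula) (hφ : Formula.InLang n φ) :
      Jn n (Formula.imp (Formula.box k φ) (Formula.box m (Formula.box k φ)))
  | diaMono {k m : ℕ} (hkm : k < m) (hm : m < n) (φ : Formula) (hφ : Formula.InLang n φ) :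
      Jn n (Formula.imp (Formula.dia k φ) (Formula.box m (Formula.dia k φ)))
  | mp {φ ψ : Formula} : Jn n (Formula.imp φ ψ) → Jn n φ → Jn n ψ
  | nec {k : ℕ} (hk : k < n) {φ : Formula} : Jn n φ → Jn n (Formula.box k φ)

/-- The logic `J_n.lin`: `J_n` together with the pseudo-linearity axioms. -/
inductive JnLin (n : ℕ) : Formula → Prop
  | taut {φ : Formula} : Tautology φ → Formula.InLang n φ → JnLin n φ
  | distr {k : ℕ} (hk : k < n) (φ ψ : Formula)
      (hφ : Formula.InLang n φ) (hψ : Formula.InLang n ψ) :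
      JnLin n (Formula.imp (Formula.box k (Formula.imp φ ψ))
        (Formula.imp (Formula.box k φ) (Formula.box k ψ)))
  | lob {k : ℕ} (hk : k < n) (φ : Formula) (hφ : Formula.InLang n φ) :
      JnLin n (Formula.imp (Formula.box k (Formula.imp (Formula.box k φ) φ)) (Formula.box k φ))
  | trans1 {k m : ℕ} (hkm : k ≤ m) (hm : m < n) (φ : Formula) (hφ : Formula.InLang n φ) :
      JnLin n (Formula.imp (Formula.box k φ) (Formula.box k (Formula.box m φ)))
  | trans2 {k m : ℕ} (hkm : k ≤ m) (hm : m < n) (φ : Formula) (hφ : Formula.InLang n φ) :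
      JnLin n (Formula.imp (Formula.box k φ) (Formula.box m (Formula.box k φ)))
  | diaMono {k m : ℕ} (hkm : k < m) (hm : m < n) (φ : Formula) (hφ : Formula.InLang n φ) :
      JnLin n (Formula.imp (Formula.dia k φ) (Formula.box m (Formula.dia k φ)))
  | lin {m : ℕ} (hm : m < n) (φ ψ : Formula)
      (hφ : Formula.InLang n φ) (hψ : Formula.InLang n ψ) :
      JnLin n (psLin n m φ ψ)
  | mp {φ ψ : Formula} : JnLin n (Formula.imp φ ψ) → JnLin n φ → JnLin n ψ
  | nec {k : ℕ} (hk : k < n) {φ : Formula} : JnLin n φ → JnLin n (Formula.box k φ)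

section Frames

variable {T : Type*}

/-- `(T, <_0, …, <_{n-1})` (encoded as `R : ℕ → T → T → Prop`, only the
relations `R i` for `i < n` being relevant) is a `J_n`-frame. -/
def IsJnFrame (n : ℕ) (R : ℕ → T → T → Prop) : Prop :=
  (∀ i < n, Irreflexive (R i)) ∧
  (∀ i < n, Transitive (R i)) ∧
  (∀ i < n, WellFounded fun a b => R i b a) ∧
  ∀ ⦃k m : ℕ⦄, k < m → m < n →
    (∀ ⦃x y z : T⦄, R m x y → R k y z → R k x z) ∧
    (∀ ⦃x y z : T⦄, R k x y → R m y z → R k x z) ∧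
    (∀ ⦃x y z : T⦄, R k x z → R m y z → R k x y)

/-- A frame is hereditarily linear if any two distinct points are comparable
by some relation `<_k`, `k < n`. -/
def HereditarilyLinear (n : ℕ) (R : ℕ → T → T → Prop) : Prop :=
  ∀ x y : T, x ≠ y → ∃ k < n, R k x y ∨ R k y x

/-- A frame is stratified if `x <_m y` and `z <_k y` imply `x <_m z` for `k < m < n`. -/
def Stratified (n : ℕ) (R : ℕ → T → T → Prop) : Prop :=
  ∀ ⦃k m : ℕ⦄, k < m → m < n → ∀ ⦃x y z : T⦄, R m x y → R k z y → R m x z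

/-- The relations `≡_k` (for `k ≤ n`): `≡_n` is identity and `≡_k` is the
equivalence relation generated by the union of `<_k` and `≡_{k+1}`.
Equivalence classes of `≡_k` are the `k`-planes. -/
def eqvRel (R : ℕ → T → T → Prop) (n : ℕ) (k : ℕ) : T → T → Prop :=
  if _ : k < n then
    Relation.EqvGen fun x y => R k x y ∨ eqvRel R n (k + 1) x y
  else Eq
termination_by n - k
decreasing_by omega

/-- Kripke satisfaction in the model `(T, R, V)`. -/
def Sat (R : ℕ → T → T → Prop) (V : ℕ → T → Prop) : T → Formula → Prop
  | w, Formula.var p => V p w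
  | _, Formula.top => True
  | w, Formula.neg a => ¬ Sat R V w a
  | w, Formula.and a b => Sat R V w a ∧ Sat R V w b
  | w, Formula.or a b => Sat R V w a ∨ Sat R V w b
  | w, Formula.imp a b => Sat R V w a → Sat R V w b
  | w, Formula.box m a => ∀ v : T, R m w v → Sat R V v a

end Frames

/-- A set of formulas is consistent with the logic `L` if no finite conjunction
of its elements has its negation provable in `L`. -/
def SetConsistent (L : Formula → Prop) (S : Set Formula) : Prop :=
  ∀ l : List Formula, (∀ φ ∈ l, φ ∈ S) → ¬ L (Formula.neg (bigConj l))

/-- A maximal `L`-consistent set of `L_{[<n]}`-formulas. -/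
def MCS (L : Formula → Prop) (n : ℕ) (S : Set Formula) : Prop :=
  (∀ φ ∈ S, Formula.InLang n φ) ∧ SetConsistent L S ∧
  ∀ S' : Set Formula, (∀ φ ∈ S', Formula.InLang n φ) → S ⊆ S' → S ≠ S' → ¬ SetConsistent L S'

/-- The canonical accessibility relation `x <_m y`. -/
def canonR (m : ℕ) (x y : Set Formula) : Prop :=
  (∀ ψ : Formula, Formula.box m ψ ∈ x → ψ ∈ y) ∧
  (∃ ψ : Formula, Formula.box m ψ ∈ y ∧ Formula.box m ψ ∉ x)

/-- A set of formulas is `k`-maximal if it contains `¬ψ ∧ ⋀_{k≤m<n}[m]ψ` for some `ψ`. -/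
def kMaximal (n k : ℕ) (S : Set Formula) : Prop :=
  ∃ ψ : Formula, Formula.and (Formula.neg ψ) (boxConj k n ψ) ∈ S

theorem RespectsBool.bigConj_eq_true {v : Formula → Bool} (hv : RespectsBool v) (l : List Formula) :
    v (bigConj l) = true ↔ ∀ a ∈ l, v a = true := by
  obtain ⟨htop, -, hand, -, -⟩ := hv
  induction l with
  | nil => simpa [bigConj] using htop
  | cons a l ih =>
    have h : v (bigConj (a :: l)) = (v a && v (bigConj l)) := hand _ _
    simp [h, ih]

theorem inLang_bigConj {n : ℕ} {l : List Formula} :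
    Formula.InLang n (bigConj l) ↔ ∀ a ∈ l, Formula.InLang n a := by
  induction l with
  | nil => simp [bigConj, Formula.InLang]
  | cons a l ih =>
    have h : Formula.InLang n (bigConj (a :: l)) ↔
        Formula.InLang n a ∧ Formula.InLang n (bigConj l) := Iff.rfl
    simp [h, ih]

theorem inLang_boxConj {n : ℕ} (m : ℕ) {φ : Formula} (hφ : Formula.InLang n φ) :
    Formula.InLang n (boxConj m n φ) := by
  refine inLang_bigConj.2 fun a ha => ?_
  obtain ⟨k, hk, rfl⟩ := List.mem_map.1 ha
  have hk := List.mem_range'_1.1 hk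
  exact ⟨by omega, hφ⟩

theorem boxConj_self (n : ℕ) (φ : Formula) : boxConj n n φ = Formula.top := by
  simp [boxConj, bigConj]

theorem boxConj_of_lt {m n : ℕ} (h : m < n) (φ : Formula) :
    boxConj m n φ = Formula.and (Formula.box m φ) (boxConj (m + 1) n φ) := by
  obtain ⟨d, rfl⟩ : ∃ d, n = m + 1 + d := ⟨n - (m + 1), by omega⟩
  have h₁ : m + 1 + d - m = d + 1 := by omega
  have h₂ : m + 1 + d - (m + 1) = d := by omega
  simp [boxConj, bigConj, h₁, h₂, List.range'_succ]

/-- Theorems of `J_n.lin` are closed under propositional consequence within the language. -/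
theorem JnLin.of_entails {n : ℕ} {a b : Formula} (h : JnLin n a) (ha : Formula.InLang n a)
    (hb : Formula.InLang n b)
    (hab : ∀ v : Formula → Bool, RespectsBool v → v a = true → v b = true) : JnLin n b := by
  refine .mp (.taut (fun v hv => ?_) ⟨ha, hb⟩) h
  have := hab v hv
  rw [hv.2.2.2.2]
  cases h' : v a <;> simp_all

theorem JnLin.and_intro {n : ℕ} {a b : Formula} (h₁ : JnLin n a) (h₂ : JnLin n b)
    (ha : Formula.InLang n a) (hb : Formula.InLang n b) : JnLin n (Formula.and a b) := by
  refine .mp (.mp (.taut (fun v hv => ?_) ⟨ha, hb, ha, hb⟩) h₁) h₂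
  obtain ⟨-, -, hand, -, himp⟩ := hv
  simp only [hand, himp]
  cases v a <;> cases v b <;> rfl

theorem JnLin.imp_trans {n : ℕ} {a b c : Formula} (h₁ : JnLin n (Formula.imp a b))
    (h₂ : JnLin n (Formula.imp b c)) (ha : Formula.InLang n a) (hb : Formula.InLang n b)
    (hc : Formula.InLang n c) : JnLin n (Formula.imp a c) := by
  refine (h₁.and_intro h₂ ⟨ha, hb⟩ ⟨hb, hc⟩).of_entails ⟨⟨ha, hb⟩, hb, hc⟩ ⟨ha, hc⟩ fun v hv => ?_
  obtain ⟨-, -, hand, -, himp⟩ := hv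
  simp only [hand, himp]
  cases v a <;> cases v b <;> cases v c <;> decide

theorem JnLin.box_imp {n k : ℕ} (hk : k < n) {a b : Formula} (h : JnLin n (Formula.imp a b))
    (ha : Formula.InLang n a) (hb : Formula.InLang n b) :
    JnLin n (Formula.imp (Formula.box k a) (Formula.box k b)) :=
  .mp (.distr hk a b ha hb) (.nec hk h)

theorem JnLin.box_and {n k : ℕ} (hk : k < n) {a b : Formula}
    (ha : Formula.InLang n a) (hb : Formula.InLang n b) :
    JnLin n (Formula.imp (Formula.and (Formula.box k a) (Formula.box k b))
      (Formula.box k (Formula.and a b))) := by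
  have h : JnLin n (Formula.imp a (Formula.imp b (Formula.and a b))) := by
    refine .taut (fun v hv => ?_) ⟨ha, hb, ha, hb⟩
    obtain ⟨-, -, hand, -, himp⟩ := hv
    simp only [hand, himp]
    cases v a <;> cases v b <;> rfl
  have h₁ := (h.box_imp hk ha ⟨hb, ha, hb⟩).imp_trans (.distr hk b _ hb ⟨ha, hb⟩)
    ⟨hk, ha⟩ ⟨hk, hb, ha, hb⟩ ⟨⟨hk, hb⟩, hk, ha, hb⟩
  refine h₁.of_entails ⟨⟨hk, ha⟩, ⟨hk, hb⟩, hk, ha, hb⟩ ⟨⟨⟨hk, ha⟩, hk, hb⟩, hk, ha, hb⟩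
    fun v hv => ?_
  obtain ⟨-, -, hand, -, himp⟩ := hv
  simp only [hand, himp]
  cases v (Formula.box k a) <;> cases v (Formula.box k b) <;> simp

/-- Löb's rule for `⋀_{m≤k<n}[k]`, relative to a hypothesis `χ` that persists along every
modality `[k]` with `m ≤ k < n`. -/
theorem JnLin.loeb_boxConj {n : ℕ} {ψ : Formula} (hψ : Formula.InLang n ψ) {m : ℕ} (hmn : m ≤ n) :
    ∀ χ : Formula, Formula.InLang n χ →
      (∀ k, m ≤ k → k < n → JnLin n (Formula.imp χ (Formula.box k χ))) →
      JnLin n (Formula.imp χ (Formula.imp (boxConj m n ψ) ψ)) →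
      JnLin n (Formula.imp χ ψ) := by
  induction hmn using Nat.decreasingInduction with
  | self =>
    intro χ hχ _ h
    rw [boxConj_self] at h
    refine h.of_entails ⟨hχ, trivial, hψ⟩ ⟨hχ, hψ⟩ fun v hv => ?_
    obtain ⟨htop, -, -, -, himp⟩ := hv
    simp [himp, htop]
  | of_succ m hm ih =>
    intro χ hχ hpers h
    have hm : m < n := hm
    have hbox : Formula.InLang n (Formula.box m ψ) := ⟨hm, hψ⟩
    have hC := inLang_boxConj (m + 1) hψ
    have hstep : JnLin n (Formula.imp (Formula.and χ (Formula.box m ψ)) ψ) := by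
      refine ih _ ⟨hχ, hbox⟩ (fun k hk hkn => ?_) ?_
      · have h₁ := (hpers k (by omega) hkn).and_intro (.trans2 (by omega : m ≤ k) hkn ψ hψ)
          ⟨hχ, hkn, hχ⟩ ⟨hbox, hkn, hbox⟩
        have h₂ : JnLin n (Formula.imp (Formula.and χ (Formula.box m ψ))
            (Formula.and (Formula.box k χ) (Formula.box k (Formula.box m ψ)))) := by
          refine h₁.of_entails ⟨⟨hχ, hkn, hχ⟩, hbox, hkn, hbox⟩
            ⟨⟨hχ, hbox⟩, ⟨hkn, hχ⟩, hkn, hbox⟩ fun v hv => ?_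
          obtain ⟨-, -, hand, -, himp⟩ := hv
          simp only [hand, himp]
          cases v χ <;> cases v (Formula.box m ψ) <;> simp
        exact h₂.imp_trans (.box_and hkn hχ hbox) ⟨hχ, hbox⟩ ⟨⟨hkn, hχ⟩, hkn, hbox⟩
          ⟨hkn, hχ, hbox⟩
      · rw [boxConj_of_lt hm] at h
        refine h.of_entails ⟨hχ, ⟨hbox, hC⟩, hψ⟩ ⟨⟨hχ, hbox⟩, hC, hψ⟩ fun v hv => ?_
        obtain ⟨-, -, hand, -, himp⟩ := hv
        simp only [hand, himp]
        cases v χ <;> cases v (Formula.box m ψ) <;> simp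
    have hcurry : JnLin n (Formula.imp χ (Formula.imp (Formula.box m ψ) ψ)) := by
      refine hstep.of_entails ⟨⟨hχ, hbox⟩, hψ⟩ ⟨hχ, hbox, hψ⟩ fun v hv => ?_
      obtain ⟨-, -, hand, -, himp⟩ := hv
      simp only [hand, himp]
      cases v χ <;> cases v (Formula.box m ψ) <;> simp
    have hχbox : JnLin n (Formula.imp χ (Formula.box m ψ)) :=
      ((hpers m le_rfl hm).imp_trans (hcurry.box_imp hm hχ ⟨hbox, hψ⟩)
        hχ ⟨hm, hχ⟩ ⟨hm, hbox, hψ⟩).imp_trans (.lob hm ψ hψ) hχ ⟨hm, hbox, hψ⟩ hbox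
    refine (hχbox.and_intro hstep ⟨hχ, hbox⟩ ⟨⟨hχ, hbox⟩, hψ⟩).of_entails
      ⟨⟨hχ, hbox⟩, ⟨hχ, hbox⟩, hψ⟩ ⟨hχ, hψ⟩ fun v hv => ?_
    obtain ⟨-, -, hand, -, himp⟩ := hv
    simp only [hand, himp]
    cases v χ <;> cases v (Formula.box m ψ) <;> simp

/-- If `⋀_{k<n}[k]ψ → ψ` is a theorem of `J_n.lin`, then so is `ψ`. -/
theorem JnLin.of_boxConj_imp {n : ℕ} {ψ : Formula} (hψ : Formula.InLang n ψ)
    (h : JnLin n (Formula.imp (boxConj 0 n ψ) ψ)) : JnLin n ψ := by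
  have htop : JnLin n Formula.top := .taut (fun _ hv => hv.1) trivial
  have hC := inLang_boxConj 0 hψ
  have weaken {a : Formula} (ha : Formula.InLang n a) (h : JnLin n a) :
      JnLin n (Formula.imp Formula.top a) :=
    h.of_entails ha ⟨trivial, ha⟩ fun v hv hva => by rw [hv.2.2.2.2, hva, Bool.or_true]
  exact .mp (JnLin.loeb_boxConj hψ (Nat.zero_le n) Formula.top trivial
    (fun k _ hk => weaken ⟨hk, trivial⟩ (.nec hk htop)) (weaken ⟨hC, hψ⟩ h)) htop

/-- Lindenbaum's lemma. -/
theorem SetConsistent.exists_mcs {L : Formula → Prop} {n : ℕ} {S : Set Formula}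
    (hlang : ∀ φ ∈ S, Formula.InLang n φ) (hS : SetConsistent L S) :
    ∃ x, S ⊆ x ∧ MCS L n x := by
  obtain ⟨x, hSx, hx⟩ := zorn_subset_nonempty
    {T : Set Formula | (∀ φ ∈ T, Formula.InLang n φ) ∧ SetConsistent L T} (by
      intro c hc hchain hne
      refine ⟨⋃₀ c, ⟨?_, ?_⟩, fun s hs => Set.subset_sUnion_of_mem hs⟩
      · rintro φ ⟨T, hT, hφ⟩
        exact (hc hT).1 φ hφ
      · intro l hl
        obtain ⟨T, hT, hlT⟩ := hchain.directedOn.exists_mem_subset_of_finite_of_subset_sUnion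
          hne l.finite_toSet hl
        exact (hc hT).2 l hlT) S ⟨hlang, hS⟩
  exact ⟨x, hSx, hx.prop.1, hx.prop.2, fun S' hl hsub hne hcons =>
    hne (hx.eq_of_subset ⟨hl, hcons⟩ hsub)⟩

/-- The set of propositional consequences of a consistent formula is consistent. -/
theorem JnLin.setConsistent_entails {n : ℕ} {θ : Formula} (hθ : Formula.InLang n θ)
    (hcons : ¬ JnLin n (Formula.neg θ)) :
    SetConsistent (JnLin n) {α | Formula.InLang n α ∧
      ∀ v : Formula → Bool, RespectsBool v → v θ = true → v α = true} := by
  intro l hl h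
  refine hcons (h.of_entails (inLang_bigConj.2 fun a ha => (hl a ha).1) hθ fun v hv hvl => ?_)
  have hneg := hv.2.1
  rw [hneg, Bool.not_eq_true'] at hvl ⊢
  by_contra hvθ
  have : v (bigConj l) = true := (hv.bigConj_eq_true l).2 fun a ha =>
    (hl a ha).2 v hv (by simpa using hvθ)
  simp [this] at hvl

/-- If `φ` is an `L_{[<n]}`-formula consistent with `J_n.lin`, then there is a
maximal `J_n.lin`-consistent set `x*` containing `φ` which is `0`-maximal;
indeed `φ ∧ ⋀_{k<n}[k]¬φ ∈ x*` (0-maximality witnessed by `¬φ`). -/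
theorem exists_zero_maximal (n : ℕ) (φ : Formula) (hφ : Formula.InLang n φ)
    (hcons : ¬ JnLin n (Formula.neg φ)) :
    ∃ x : Set Formula, MCS (JnLin n) n x ∧ φ ∈ x ∧ kMaximal n 0 x ∧
      Formula.and φ (boxConj 0 n (Formula.neg φ)) ∈ x := by
  have hC : Formula.InLang n (boxConj 0 n (Formula.neg φ)) := inLang_boxConj 0 hφ
  have hθ : ¬ JnLin n (Formula.neg (Formula.and φ (boxConj 0 n (Formula.neg φ)))) := by
    intro h
    refine hcons (JnLin.of_boxConj_imp hφ (h.of_entails ⟨hφ, hC⟩ ⟨hC, hφ⟩ fun v hv => ?_))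
    obtain ⟨-, hneg, hand, -, himp⟩ := hv
    simp only [hneg, hand, himp]
    cases v φ <;> simp
  obtain ⟨x, hsub, hx⟩ :=
    (JnLin.setConsistent_entails (show Formula.InLang n (.and _ _) from ⟨hφ, hC⟩) hθ).exists_mcs
      fun _ h => h.1
  refine ⟨x, hx, hsub ⟨hφ, fun v hv => ?_⟩, ⟨Formula.neg φ, hsub ⟨⟨hφ, hC⟩, fun v hv => ?_⟩⟩,
    hsub ⟨⟨hφ, hC⟩, fun _ _ h => h⟩⟩
  · rw [hv.2.2.1, Bool.and_eq_true]
    exact And.left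
  · rw [hv.2.2.1, hv.2.2.1, hv.2.1, hv.2.1, Bool.not_not]
    exact id
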